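/- The min-norm Pareto-integrated gradient is a common descent direction: Let E be a real inner product space and let g₁, g₂ ∈ E. Let α* ∈ [0, 1] be a minimizer of α ↦ ‖α g₁ + (1 − α) g₂‖ over [0, 1], and set g* = α* g₁ + (1 − α*) g₂. Then ⟪g*, g₁⟫ ≥ ‖g*‖² and ⟪g*, g₂⟫ ≥ ‖g*‖². In particular, if g* ≠ 0 then g* has strictly positive inner product with both g₁ and g₂, so the negative of g* is a descent direction for both objectives simultaneously. -/

import Mathlib

open RealInnerProductSpace

/-- If `g` has minimal norm on the segment from `g` to `x`, then `‖g‖ ^ 2 ≤ ⟪g, x⟫`. -/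
theorem norm_sq_le_inner_of_norm_le_segment {E : Type*} [NormedAddCommGroup E]
    [InnerProductSpace ℝ E] {g x : E}
    (h : ∀ t : ℝ, 0 ≤ t → t ≤ 1 → ‖g‖ ≤ ‖g + t • (x - g)‖) : ‖g‖ ^ 2 ≤ ⟪g, x⟫ := by
  by_contra! hlt
  set c := ‖g‖ ^ 2 - ⟪g, x⟫ with hc_def
  set D := ‖x - g‖ ^ 2 with hD_def
  have hc : 0 < c := sub_pos.mpr hlt
  have hD : 0 ≤ D := sq_nonneg _
  have hcD : 0 < c + D := by positivity
  have hinner : ⟪g, x - g⟫ = -c := by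
    rw [inner_sub_right, real_inner_self_eq_norm_sq]
    ring
  obtain ⟨t, ht⟩ : ∃ t, t = c / (c + D) := ⟨_, rfl⟩
  have ht0 : 0 < t := ht ▸ div_pos hc hcD
  have ht1 : t ≤ 1 := ht ▸ div_le_one_of_le₀ (by linarith) hcD.le
  have htD : t * (c + D) = c := by rw [ht, div_mul_cancel₀ _ hcD.ne']
  have hsq := pow_le_pow_left₀ (norm_nonneg g) (h t ht0.le ht1) 2
  rw [norm_add_sq_real, inner_smul_right, hinner, norm_smul, mul_pow, Real.norm_eq_abs,
    sq_abs, ← hD_def] at hsq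
  nlinarith [mul_pos ht0 hc, mul_pos ht0 (mul_pos ht0 hc)]

/-- The min-norm Pareto-integrated gradient is a common descent direction: if
`α* ∈ [0, 1]` minimizes `α ↦ ‖α • g₁ + (1 - α) • g₂‖` over `[0, 1]` and
`g* = α* • g₁ + (1 - α*) • g₂`, then `⟪g*, g₁⟫ ≥ ‖g*‖²` and `⟪g*, g₂⟫ ≥ ‖g*‖²`;
in particular, if `g* ≠ 0` then `g*` has strictly positive inner product with both
`g₁` and `g₂`. -/
theorem min_norm_common_descent {E : Type*} [NormedAddCommGroup E]
    [InnerProductSpace ℝ E] (g₁ g₂ : E) (αs : ℝ) (h0 : 0 ≤ αs) (h1 : αs ≤ 1)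
    (hmin : ∀ α : ℝ, 0 ≤ α → α ≤ 1 →
      ‖αs • g₁ + (1 - αs) • g₂‖ ≤ ‖α • g₁ + (1 - α) • g₂‖) :
    ‖αs • g₁ + (1 - αs) • g₂‖ ^ 2 ≤ ⟪αs • g₁ + (1 - αs) • g₂, g₁⟫ ∧
    ‖αs • g₁ + (1 - αs) • g₂‖ ^ 2 ≤ ⟪αs • g₁ + (1 - αs) • g₂, g₂⟫ ∧
    (αs • g₁ + (1 - αs) • g₂ ≠ 0 →
      0 < ⟪αs • g₁ + (1 - αs) • g₂, g₁⟫ ∧ 0 < ⟪αs • g₁ + (1 - αs) • g₂, g₂⟫) := by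
  have hfirst : ‖αs • g₁ + (1 - αs) • g₂‖ ^ 2 ≤ ⟪αs • g₁ + (1 - αs) • g₂, g₁⟫ := by
    refine norm_sq_le_inner_of_norm_le_segment fun t ht0 ht1 => ?_
    convert hmin (αs + t * (1 - αs)) (by nlinarith) (by nlinarith) using 2
    module
  have hsecond : ‖αs • g₁ + (1 - αs) • g₂‖ ^ 2 ≤ ⟪αs • g₁ + (1 - αs) • g₂, g₂⟫ := by
    refine norm_sq_le_inner_of_norm_le_segment fun t ht0 ht1 => ?_
    convert hmin (αs * (1 - t)) (by nlinarith) (by nlinarith) using 2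
    module
  refine ⟨hfirst, hsecond, fun hne => ?_⟩
  have hpos := pow_pos (norm_pos_iff.mpr hne) 2
  exact ⟨hpos.trans_le hfirst, hpos.trans_le hsecond⟩
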